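/- For q ≥ 5 and n a positive divisor of q, the genus of the modular curve X_q^n = (ℍ ∪ ℚ ∪ {∞})/Γ_q^n equals 1 + ((q - 6·𝒩(q/n))·n·q/24)·∏_{p | q, p prime}(1 - 1/p²), where 𝒩(ℓ^r) = 1 + r(ℓ-1)/(ℓ+1) defines a multiplicative function. -/

import Mathlib

open Matrix CongruenceSubgroup

local notation "SL2Z" => Matrix.SpecialLinearGroup (Fin 2) ℤ

/-- `±Γ` : the subgroup generated by `Γ` and `-1`. -/
def pm (Γ : Subgroup SL2Z) : Subgroup SL2Z := Γ ⊔ Subgroup.zpowers (-1)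

/-- Matrices in `SL(2, ℤ)` whose upper-right entry is divisible by `n`. -/
def GammaUpper (n : ℕ) : Subgroup SL2Z where
  carrier := { g | ((g 0 1 : ℤ) : ZMod n) = 0 }
  one_mem' := by simp
  mul_mem' := by
    intro a b ha hb
    have h := (Matrix.two_mul_expl a.1 b.1).2.1
    simp only [Set.mem_setOf_eq] at *
    rw [Matrix.SpecialLinearGroup.coe_mul, h]
    push_cast
    rw [ha, hb]
    ring
  inv_mem' := by
    intro a ha
    simp only [Set.mem_setOf_eq] at *
    rw [Matrix.SpecialLinearGroup.SL2_inv_expl a]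
    simp [ha]

/-- The group `Γ_q^n`: `a ≡ d ≡ 1, c ≡ 0 (mod q)` and `b ≡ 0 (mod n)`. -/
def GammaQN (q n : ℕ) : Subgroup SL2Z := Gamma1 q ⊓ GammaUpper n

/-- The Möbius action of `SL(2, ℤ)` on `ℚ ∪ {∞}`, with `∞` encoded as `none`. -/
def moebius (g : Matrix.SpecialLinearGroup (Fin 2) ℤ) (x : Option ℚ) : Option ℚ :=
  match x with
  | none => if ((g.1 1 0 : ℤ) : ℚ) = 0 then none
      else some (((g.1 0 0 : ℤ) : ℚ) / ((g.1 1 0 : ℤ) : ℚ))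
  | some t => if ((g.1 1 0 : ℤ) : ℚ) * t + ((g.1 1 1 : ℤ) : ℚ) = 0 then none
      else some ((((g.1 0 0 : ℤ) : ℚ) * t + ((g.1 0 1 : ℤ) : ℚ)) /
        (((g.1 1 0 : ℤ) : ℚ) * t + ((g.1 1 1 : ℤ) : ℚ)))

/-- Two cusps are `Γ`-equivalent if some element of `Γ` maps one to the other. -/
def cuspRel (G : Subgroup (Matrix.SpecialLinearGroup (Fin 2) ℤ)) (x y : Option ℚ) : Prop :=
  ∃ γ ∈ G, moebius γ x = y

/-- The number of cusps of `Γ`, i.e. the number of `Γ`-orbits on `ℚ ∪ {∞}`. -/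
noncomputable def numCusps (G : Subgroup (Matrix.SpecialLinearGroup (Fin 2) ℤ)) : ℕ :=
  Nat.card (Quot (cuspRel G))

/-- The multiplicative function `𝒩` with `𝒩(p^r) = 1 + r(p-1)/(p+1)` for primes `p`. -/
def calN (m : ℕ) : ℚ :=
  ∏ p ∈ m.primeFactors, (1 + (m.factorization p) * ((p : ℚ) - 1) / ((p : ℚ) + 1))

/-- Euler's totient function with rational values. -/
def totientQ : ArithmeticFunction ℚ := ⟨fun k => (k.totient : ℚ), by simp⟩

/-- The function `g ↦ gcd(m, g) φ(g) / g`. -/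
def gcdWeight (m : ℕ) : ArithmeticFunction ℚ :=
  ⟨fun g => (m.gcd g : ℚ) * g.totient / g, by simp⟩

lemma totientQ_apply (k : ℕ) : totientQ k = k.totient := rfl

lemma gcdWeight_apply (m g : ℕ) : gcdWeight m g = (m.gcd g : ℚ) * g.totient / g := rfl

lemma isMultiplicative_totientQ : totientQ.IsMultiplicative := by
  refine ⟨by simp [totientQ_apply], fun {a b} h => ?_⟩
  simp [totientQ_apply, Nat.totient_mul h]

lemma isMultiplicative_gcdWeight (m : ℕ) : (gcdWeight m).IsMultiplicative := by
  refine ⟨by simp [gcdWeight_apply], fun {a b} h => ?_⟩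
  simp only [gcdWeight_apply, Nat.totient_mul h, h.gcd_mul m]
  push_cast
  ring

lemma totientQ_mul_gcdWeight_prime_pow (m : ℕ) {p : ℕ} (hp : p.Prime) (k : ℕ) :
    (totientQ * gcdWeight m) (p ^ k) =
      ∑ i ∈ Finset.range (k + 1), totientQ (p ^ (k - i)) * gcdWeight m (p ^ i) := by
  rw [ArithmeticFunction.mul_apply,
    Nat.sum_divisorsAntidiagonal' (f := fun x y => totientQ x * gcdWeight m y),
    Nat.sum_divisors_prime_pow hp]
  refine Finset.sum_congr rfl fun i hi => ?_
  rw [Nat.pow_div (Nat.lt_succ_iff.mp (Finset.mem_range.mp hi)) hp.pos]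

lemma totientQ_mul_gcdWeight_prime_pow_succ (m : ℕ) {p : ℕ} (hp : p.Prime) (k : ℕ) :
    (totientQ * gcdWeight m) (p ^ (k + 1)) = p * (totientQ * gcdWeight m) (p ^ k) +
      gcdWeight m (p ^ (k + 1)) - gcdWeight m (p ^ k) := by
  rw [totientQ_mul_gcdWeight_prime_pow m hp, totientQ_mul_gcdWeight_prime_pow m hp,
    Finset.sum_range_succ, Finset.sum_range_succ, Finset.sum_range_succ _ k, mul_add,
    Finset.mul_sum]
  have h : ∀ i ∈ Finset.range k, totientQ (p ^ (k + 1 - i)) * gcdWeight m (p ^ i) =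
      p * (totientQ (p ^ (k - i)) * gcdWeight m (p ^ i)) := by
    intro i hi
    obtain ⟨j, rfl⟩ := Nat.exists_eq_add_of_lt (Finset.mem_range.mp hi)
    rw [show i + j + 1 + 1 - i = (j + 1) + 1 by lia, show i + j + 1 - i = j + 1 by lia]
    simp only [totientQ_apply, Nat.totient_prime_pow_succ hp]
    push_cast
    ring
  rw [Finset.sum_congr rfl h]
  have h1 : totientQ p = p - 1 := by
    rw [totientQ_apply, Nat.totient_prime hp, Nat.cast_sub hp.one_le, Nat.cast_one]
  simp only [Nat.add_sub_cancel_left, Nat.sub_self, pow_zero, pow_one, h1,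
    isMultiplicative_totientQ.map_one]
  ring

lemma gcdWeight_prime_pow {m p : ℕ} (hm : m ≠ 0) (hp : p.Prime) (k : ℕ) :
    gcdWeight m (p ^ (k + 1)) =
      (p : ℚ) ^ min (m.factorization p) (k + 1) * (p - 1) / p := by
  have hp0 : (p : ℚ) ≠ 0 := by exact_mod_cast hp.ne_zero
  have hg : m.gcd (p ^ (k + 1)) = p ^ min (m.factorization p) (k + 1) := by
    refine Nat.eq_of_factorization_eq (Nat.gcd_ne_zero_left hm) (pow_ne_zero _ hp.ne_zero) fun l => ?_
    rw [Nat.factorization_gcd hm (pow_ne_zero _ hp.ne_zero), hp.factorization_pow,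
      hp.factorization_pow, Finsupp.inf_apply, Finsupp.single_apply, Finsupp.single_apply]
    split_ifs with h
    · rw [h]
    · simp
  rw [gcdWeight_apply, hg, Nat.totient_prime_pow_succ hp]
  push_cast [Nat.cast_sub hp.one_le]
  field_simp
  ring

lemma totientQ_mul_gcdWeight_prime_pow_eq {m p : ℕ} (hm : m ≠ 0) (hp : p.Prime) (k : ℕ) :
    (totientQ * gcdWeight m) (p ^ (k + 1)) = (p : ℚ) ^ (k + 1) *
      (1 + (min (m.factorization p) (k + 1) : ℕ) * ((p : ℚ) - 1) / (p + 1)) *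
      (1 - 1 / (p : ℚ) ^ 2) := by
  have hp0 : (p : ℚ) ≠ 0 := by exact_mod_cast hp.ne_zero
  have hp1 : (p : ℚ) + 1 ≠ 0 := by positivity
  induction k with
  | zero =>
    rw [totientQ_mul_gcdWeight_prime_pow_succ m hp, gcdWeight_prime_pow hm hp, pow_zero,
      (isMultiplicative_totientQ.mul (isMultiplicative_gcdWeight m)).map_one,
      (isMultiplicative_gcdWeight m).map_one]
    rcases Nat.eq_zero_or_pos (m.factorization p) with h | h
    · rw [h]
      simp
      field_simp
      ring
    · rw [show min (m.factorization p) (0 + 1) = 1 by lia]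
      simp
      field_simp
      ring
  | succ k ih =>
    rw [totientQ_mul_gcdWeight_prime_pow_succ m hp, gcdWeight_prime_pow hm hp,
      gcdWeight_prime_pow hm hp, ih]
    rcases le_or_gt (m.factorization p) (k + 1) with h | h
    · rw [min_eq_left h, min_eq_left (h.trans (Nat.le_succ _))]
      ring
    · rw [min_eq_right h.le, show min (m.factorization p) (k + 1 + 1) = k + 1 + 1 by lia]
      push_cast
      field_simp
      ring

lemma totientQ_mul_gcdWeight_eq {m q : ℕ} (hq : q ≠ 0) (hm : m ∣ q) :
    (totientQ * gcdWeight m) q = q * calN m * ∏ p ∈ q.primeFactors, (1 - 1 / (p : ℚ) ^ 2) := by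
  have hm0 : m ≠ 0 := ne_zero_of_dvd_ne_zero hq hm
  rw [(isMultiplicative_totientQ.mul (isMultiplicative_gcdWeight m)).multiplicative_factorization
    _ hq, Nat.prod_factorization_eq_prod_primeFactors]
  have hfac : ∀ p ∈ q.primeFactors, (totientQ * gcdWeight m) (p ^ q.factorization p) =
      ((p ^ q.factorization p : ℕ) : ℚ) *
        (1 + m.factorization p * ((p : ℚ) - 1) / (p + 1)) * (1 - 1 / (p : ℚ) ^ 2) := by
    intro p hp
    have hpp := Nat.prime_of_mem_primeFactors hp
    have hle := (Nat.factorization_le_iff_dvd hm0 hq).mpr hm p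
    have hpos := hpp.factorization_pos_of_dvd hq (Nat.dvd_of_mem_primeFactors hp)
    obtain ⟨k, hk⟩ := Nat.exists_eq_add_of_le' hpos
    have h := totientQ_mul_gcdWeight_prime_pow_eq hm0 hpp k
    rw [← hk, min_eq_left hle] at h
    rw [h]
    push_cast
    rfl
  rw [Finset.prod_congr rfl hfac, Finset.prod_mul_distrib, Finset.prod_mul_distrib,
    ← Nat.cast_prod, ← Nat.prod_factorization_eq_prod_primeFactors (fun p k => p ^ k),
    Nat.prod_factorization_pow_eq_self hq]
  congr 2
  refine (Finset.prod_subset (Nat.primeFactors_mono hm hq) fun p _ hp => ?_).symm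
  rw [← Nat.support_factorization, Finsupp.notMem_support_iff] at hp
  simp [hp]

/-- Residues describing the orbits of `GammaQN q n` on primitive integer vectors `(x, y)`:
the pairs of `y` modulo `q` and `x` modulo `n * gcd(q / n, y)`. -/
def cuspData (q n : ℕ) : Finset (Σ _ : ℕ, ℕ) :=
  (Finset.range q).sigma fun y =>
    {x ∈ Finset.range (n * (q / n).gcd y) | (q.gcd y).Coprime x}

lemma card_filter_coprime_range_mul (a k : ℕ) :
    ((Finset.range (a * k)).filter a.Coprime).card = k * a.totient := by
  induction k with
  | zero => simp
  | succ k ih =>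
    rw [Finset.range_eq_Ico] at ih ⊢
    rw [← Finset.Ico_union_Ico_eq_Ico (Nat.zero_le (a * k)) (by lia : a * k ≤ a * (k + 1)),
      Finset.filter_union, Finset.card_union_of_disjoint, ih, mul_add_one,
      Nat.filter_coprime_Ico_eq_totient]
    · ring
    · exact Finset.disjoint_filter_filter (Finset.Ico_disjoint_Ico_consecutive _ _ _)

lemma gcd_dvd_mul_gcd_div {q n : ℕ} (hdvd : n ∣ q) (y : ℕ) : q.gcd y ∣ n * (q / n).gcd y := by
  rw [← Nat.gcd_mul_left, Nat.mul_div_cancel' hdvd]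
  exact Nat.gcd_dvd_gcd_of_dvd_right _ (dvd_mul_left _ _)

lemma card_cuspData {q n : ℕ} (hq : 0 < q) (hdvd : n ∣ q) :
    ((cuspData q n).card : ℚ) = n * (totientQ * gcdWeight (q / n)) q := by
  have hy : ∀ y, (({x ∈ Finset.range (n * (q / n).gcd y) | (q.gcd y).Coprime x} : Finset ℕ).card : ℚ)
      = n * gcdWeight (q / n) (q.gcd y) := by
    intro y
    obtain ⟨k, hk⟩ := gcd_dvd_mul_gcd_div hdvd y
    have hG : (q.gcd y : ℚ) ≠ 0 := by exact_mod_cast (Nat.gcd_pos_of_pos_left y hq).ne'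
    have hg : (q / n).gcd (q.gcd y) = (q / n).gcd y := by
      rw [← Nat.gcd_assoc, Nat.gcd_eq_left (Nat.div_dvd_of_dvd hdvd)]
    have hk' : (n : ℚ) * (q / n).gcd y = q.gcd y * k := by exact_mod_cast hk
    rw [hk, card_filter_coprime_range_mul, gcdWeight_apply, hg, mul_div_assoc', ← mul_assoc, hk']
    push_cast
    field_simp
  rw [cuspData, Finset.card_sigma, Nat.cast_sum, Finset.sum_congr rfl fun y _ => hy y,
    ← Finset.mul_sum, ArithmeticFunction.mul_apply,
    Nat.sum_divisorsAntidiagonal' (f := fun x y => totientQ x * gcdWeight (q / n) y),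
    ← Finset.sum_fiberwise_of_maps_to (s := Finset.range q) (t := q.divisors) (g := fun y => q.gcd y)
      fun y _ => Nat.mem_divisors.mpr ⟨Nat.gcd_dvd_left _ _, hq.ne'⟩]
  congr 1
  refine Finset.sum_congr rfl fun g hg => ?_
  rw [Finset.sum_congr rfl fun y hy => by rw [(Finset.mem_filter.mp hy).2], Finset.sum_const,
    totientQ_apply, Nat.totient_div_of_dvd (Nat.dvd_of_mem_divisors hg), nsmul_eq_mul]

/-- The pair of residues of `(y, x)` recorded in `cuspData q n`. -/
def cuspDatum (q n : ℕ) (x y : ℤ) : Σ _ : ℕ, ℕ :=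
  ⟨(y % q).toNat, (x % (n * Int.gcd (q / n : ℕ) y : ℕ)).toNat⟩

lemma Int.ModEq.gcd_eq_of_dvd {q m : ℕ} {y z : ℤ} (h : y ≡ z [ZMOD q]) (hm : m ∣ q) :
    Int.gcd m y = Int.gcd m z := by
  have h' := h.of_dvd (Int.natCast_dvd_natCast.mpr hm)
  rw [Int.gcd_comm, Int.gcd_comm (m : ℤ), ← Int.gcd_emod, h', Int.gcd_emod]

lemma toNat_emod_eq_iff {M : ℕ} (hM : 0 < M) (x y : ℤ) :
    (x % M).toNat = (y % M).toNat ↔ x ≡ y [ZMOD M] := by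
  have hM' : (M : ℤ) ≠ 0 := by exact_mod_cast hM.ne'
  have hx := Int.emod_nonneg x hM'
  have hy := Int.emod_nonneg y hM'
  unfold Int.ModEq
  lia

lemma cuspDatum_eq_iff {q n : ℕ} (hq : 0 < q) (hdvd : n ∣ q) (x y x' y' : ℤ) :
    cuspDatum q n x y = cuspDatum q n x' y' ↔
      y ≡ y' [ZMOD q] ∧ x ≡ x' [ZMOD (n * Int.gcd (q / n : ℕ) y : ℕ)] := by
  have hn : 0 < n := Nat.pos_of_dvd_of_pos hdvd hq
  have hm : 0 < q / n := Nat.div_pos (Nat.le_of_dvd hq hdvd) hn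
  have hM : 0 < n * Int.gcd (q / n : ℕ) y :=
    Nat.mul_pos hn (Int.gcd_pos_of_ne_zero_left _ (by exact_mod_cast hm.ne'))
  simp only [cuspDatum, Sigma.mk.inj_iff, heq_eq_eq, toNat_emod_eq_iff hq]
  refine and_congr_right fun h => ?_
  rw [← h.gcd_eq_of_dvd (Nat.div_dvd_of_dvd hdvd), toNat_emod_eq_iff hM]

lemma cuspDatum_mem_cuspData {q n : ℕ} (hq : 0 < q) (hdvd : n ∣ q) {x y : ℤ}
    (h : IsCoprime x y) : cuspDatum q n x y ∈ cuspData q n := by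
  have hn : 0 < n := Nat.pos_of_dvd_of_pos hdvd hq
  have hm : 0 < q / n := Nat.div_pos (Nat.le_of_dvd hq hdvd) hn
  have hM : 0 < n * Int.gcd (q / n : ℕ) y :=
    Nat.mul_pos hn (Int.gcd_pos_of_ne_zero_left _ (by exact_mod_cast hm.ne'))
  obtain ⟨b, hb⟩ : ∃ b : ℕ, y % q = b :=
    Int.eq_ofNat_of_zero_le (Int.emod_nonneg y (by exact_mod_cast hq.ne'))
  have hbq : y ≡ b [ZMOD q] := by rw [← hb]; exact (Int.mod_modEq y q).symm
  have hgcd : ∀ k, k ∣ q → Int.gcd k y = k.gcd b := fun k hk => by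
    rw [hbq.gcd_eq_of_dvd hk, Int.gcd_natCast_natCast]
  have hg := hgcd _ (Nat.div_dvd_of_dvd hdvd)
  rw [hg] at hM
  obtain ⟨a, ha⟩ : ∃ a : ℕ, x % (n * (q / n).gcd b : ℕ) = a :=
    Int.eq_ofNat_of_zero_le (Int.emod_nonneg x (by exact_mod_cast hM.ne'))
  have hb' : b < q := by
    have := Int.emod_lt_of_pos y (b := q) (by exact_mod_cast hq)
    lia
  have ha' : a < n * (q / n).gcd b := by
    have := Int.emod_lt_of_pos x (b := (n * (q / n).gcd b : ℕ)) (by exact_mod_cast hM)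
    lia
  have hax : x ≡ a [ZMOD (n * (q / n).gcd b : ℕ)] := by rw [← ha]; exact (Int.mod_modEq x _).symm
  simp only [cuspDatum, hg, hb, ha, Int.toNat_natCast, cuspData, Finset.mem_sigma,
    Finset.mem_range, Finset.mem_filter]
  refine ⟨hb', ha', ?_⟩
  have hax' := hax.of_dvd (Int.natCast_dvd_natCast.mpr (gcd_dvd_mul_gcd_div hdvd b))
  rw [← Nat.isCoprime_iff_coprime]
  have hcop : IsCoprime ((q.gcd b : ℕ) : ℤ) x := by
    refine (h.symm.of_isCoprime_of_dvd_left ?_)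
    rw [← hgcd q dvd_rfl]
    exact Int.gcd_dvd_right _ _
  obtain ⟨c, hc⟩ := hax'.dvd
  rw [show (a : ℤ) = x + (q.gcd b : ℕ) * c by linarith]
  exact hcop.add_mul_left_right c

lemma exists_isCoprime_modEq {a M Y : ℕ} (hM : 0 < M) (hY : 0 < Y)
    (h : (a.gcd M).Coprime Y) : ∃ X : ℕ, X.Coprime Y ∧ X ≡ a [MOD M] := by
  obtain ⟨a', M', hcop, ha, hM'⟩ := Nat.exists_coprime a M
  have hM0 : M' ≠ 0 := by rintro rfl; lia
  have : NeZero (M' * Y) := ⟨mul_ne_zero hM0 hY.ne'⟩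
  obtain ⟨u, hu⟩ := ZMod.unitsMap_surjective (Dvd.intro Y rfl : M' ∣ M' * Y)
    (ZMod.unitOfCoprime a' hcop)
  have hX := ZMod.val_coe_unit_coprime u
  refine ⟨(u : ZMod (M' * Y)).val * a.gcd M, ?_, ?_⟩
  · exact Nat.Coprime.mul_left (Nat.Coprime.coprime_mul_left_right hX) h
  · have h1 : (u : ZMod (M' * Y)).val ≡ a' [MOD M'] := by
      rw [← ZMod.natCast_eq_natCast_iff]
      have h2 := congrArg Units.val hu
      rw [ZMod.unitsMap_val, ZMod.coe_unitOfCoprime] at h2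
      rw [← h2, ZMod.natCast_val]
    have h3 := h1.mul_right' (a.gcd M)
    rwa [← hM', ← ha] at h3

lemma exists_cuspDatum_eq {q n : ℕ} (hq : 0 < q) (hdvd : n ∣ q) {t : Σ _ : ℕ, ℕ}
    (ht : t ∈ cuspData q n) : ∃ x y : ℤ, IsCoprime x y ∧ cuspDatum q n x y = t := by
  obtain ⟨b, a⟩ := t
  simp only [cuspData, Finset.mem_sigma, Finset.mem_range, Finset.mem_filter] at ht
  obtain ⟨hb, ha, hcop⟩ := ht
  obtain ⟨X, hX, hXa⟩ := exists_isCoprime_modEq (a := a) (M := n * (q / n).gcd b) (Y := b + q)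
    (by lia) (by lia) (by
      refine Nat.eq_one_of_dvd_one ?_
      have hdq : (a.gcd (n * (q / n).gcd b)).gcd (b + q) ∣ q := by
        refine ((Nat.gcd_dvd_left _ _).trans (Nat.gcd_dvd_right _ _)).trans ?_
        conv_rhs => rw [← Nat.mul_div_cancel' hdvd]
        exact mul_dvd_mul_left _ (Nat.gcd_dvd_left _ _)
      rw [← hcop]
      exact Nat.dvd_gcd (Nat.dvd_gcd hdq ((Nat.dvd_add_left hdq).mp (Nat.gcd_dvd_right _ _)))
        ((Nat.gcd_dvd_left _ _).trans (Nat.gcd_dvd_left _ _)))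
  refine ⟨X, (b + q : ℕ), Nat.isCoprime_iff_coprime.mpr hX, ?_⟩
  have hg : (q / n).gcd (b + q) = (q / n).gcd b := by
    obtain ⟨c, hc⟩ := Nat.div_dvd_of_dvd hdvd
    rw [show b + q = b + q / n * c by rw [← hc], Nat.gcd_add_mul_left_right]
  simp only [cuspDatum, Int.gcd_natCast_natCast, hg, ← Int.natCast_mod, Int.toNat_natCast,
    Nat.add_mod_right, Nat.mod_eq_of_lt hb]
  rw [hXa, Nat.mod_eq_of_lt ha]

lemma cuspDatum_ne_cuspDatum_neg {q n : ℕ} (hq : 5 ≤ q) (hdvd : n ∣ q) {x y : ℤ}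
    (h : IsCoprime x y) : cuspDatum q n x y ≠ cuspDatum q n (-x) (-y) := by
  rw [Ne, cuspDatum_eq_iff (by lia) hdvd]
  rintro ⟨hy, hx⟩
  have hy2 : (q : ℤ) ∣ 2 * y := by
    have := hy.symm.dvd
    rwa [sub_neg_eq_add, ← two_mul] at this
  have hx2 : ((n * Int.gcd (q / n : ℕ) y : ℕ) : ℤ) ∣ 2 * x := by
    have := hx.symm.dvd
    rwa [sub_neg_eq_add, ← two_mul] at this
  have hnm : (n : ℤ) * (q / n : ℕ) = q := by exact_mod_cast Nat.mul_div_cancel' hdvd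
  have hqM : (q : ℤ) ∣ 2 * (n * Int.gcd (q / n : ℕ) y : ℕ) := by
    rw [Nat.cast_mul, Int.gcd_eq_gcd_ab]
    refine ⟨2 * Int.gcdA (q / n : ℕ) y + n * Int.gcdB (q / n : ℕ) y * (hy2.choose), ?_⟩
    linear_combination (2 * Int.gcdA (q / n : ℕ) y) * hnm +
      (n * Int.gcdB (q / n : ℕ) y) * hy2.choose_spec
  have hx4 : (q : ℤ) ∣ 4 * x := by
    have := hqM.trans (mul_dvd_mul_left 2 hx2)
    rwa [show 2 * (2 * x) = 4 * x by ring] at this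
  have hy4 : (q : ℤ) ∣ 4 * y := by
    rw [show 4 * y = 2 * (2 * y) by ring]
    exact hy2.mul_left 2
  obtain ⟨u, v, huv⟩ := h
  have h4 : (q : ℤ) ∣ 4 := by
    rw [show (4 : ℤ) = u * (4 * x) + v * (4 * y) by linear_combination -4 * huv]
    exact dvd_add (hx4.mul_left _) (hy4.mul_left _)
  have := Int.le_of_dvd (by norm_num) h4
  lia

lemma card_eq_two_mul_card_of_fiber {X T Q : Type*} [Finite T] (κ : X → T) (C : X → Q) (σ : X → X)
    (hκ : Function.Surjective κ) (hC : Function.Surjective C)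
    (h : ∀ g k, C g = C k ↔ κ g = κ k ∨ κ g = κ (σ k)) (hne : ∀ g, κ g ≠ κ (σ g)) :
    Nat.card T = 2 * Nat.card Q := by
  classical
  let s := Function.surjInv hκ
  have hs : ∀ t, κ (s t) = t := Function.surjInv_eq hκ
  have hsurj : Function.Surjective fun t => C (s t) := fun c => by
    obtain ⟨g, rfl⟩ := hC c
    exact ⟨κ g, (h _ _).mpr (Or.inl (hs _))⟩
  have : Finite Q := Finite.of_surjective _ hsurj
  have := Fintype.ofFinite T
  have := Fintype.ofFinite Q
  rw [Nat.card_eq_fintype_card, Nat.card_eq_fintype_card, ← Finset.card_univ,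
    Finset.card_eq_sum_card_fiberwise (f := fun t => C (s t)) (t := Finset.univ)
      fun _ _ => Finset.mem_coe.mpr (Finset.mem_univ _)]
  have hfib : ∀ c ∈ (Finset.univ : Finset Q),
      (Finset.univ.filter fun t => C (s t) = c).card = 2 := by
    intro c _
    obtain ⟨g, rfl⟩ := hC c
    rw [← Finset.card_pair (hne g)]
    congr 1
    ext t
    simp [h, hs]
  rw [Finset.sum_congr rfl hfib]
  simp [mul_comm]

lemma Subgroup.index_eq_card_of_surjective {G T : Type*} [Group G] (H : Subgroup G) (f : G → T)
    (hf : Function.Surjective f) (h : ∀ g k, f g = f k ↔ g⁻¹ * k ∈ H) :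
    H.index = Nat.card T := by
  refine Nat.card_congr (Equiv.ofBijective
    (Quotient.lift f fun a b hab => (h a b).mpr (QuotientGroup.leftRel_apply.mp hab)) ⟨?_, ?_⟩)
  · rintro ⟨a⟩ ⟨b⟩ hab
    exact Quotient.sound (QuotientGroup.leftRel_apply.mpr ((h a b).mp hab))
  · intro t
    obtain ⟨g, rfl⟩ := hf t
    exact ⟨Quotient.mk _ g, rfl⟩

lemma mem_GammaQN {q n : ℕ} {g : SL2Z} : g ∈ GammaQN q n ↔
    (((g 0 0 : ℤ) : ZMod q) = 1 ∧ ((g 1 1 : ℤ) : ZMod q) = 1 ∧ ((g 1 0 : ℤ) : ZMod q) = 0) ∧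
      ((g 0 1 : ℤ) : ZMod n) = 0 := by
  rw [GammaQN, Subgroup.mem_inf, Gamma1_mem]
  rfl

lemma Gamma_le_GammaQN {q n : ℕ} (hdvd : n ∣ q) : Gamma q ≤ GammaQN q n := by
  intro g hg
  obtain ⟨h00, h01, h10, h11⟩ := Gamma_mem.mp hg
  refine mem_GammaQN.mpr ⟨⟨h00, h11, h10⟩, ?_⟩
  rw [ZMod.intCast_zmod_eq_zero_iff_dvd] at h01 ⊢
  exact (Int.natCast_dvd_natCast.mpr hdvd).trans h01

lemma SL2Z_mul_apply (g h : SL2Z) (i j : Fin 2) :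
    (g * h) i j = g i 0 * h 0 j + g i 1 * h 1 j := by
  change (g.1 * h.1) i j = _
  rw [Matrix.mul_apply, Fin.sum_univ_two]

lemma SL2Z_det (g : SL2Z) : g 0 0 * g 1 1 - g 0 1 * g 1 0 = 1 := by
  rw [← Matrix.det_fin_two, g.det_coe]

lemma SL2Z_inv_apply (g : SL2Z) : g⁻¹ 0 0 = g 1 1 ∧ g⁻¹ 0 1 = -g 0 1 ∧ g⁻¹ 1 0 = -g 1 0 ∧
    g⁻¹ 1 1 = g 0 0 := by
  rw [SpecialLinearGroup.SL2_inv_expl g]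
  simp

/-- The unipotent matrix with upper-right entry `k`. -/
def upperUnipotent (k : ℤ) : SL2Z := ⟨!![1, k; 0, 1], by simp⟩

lemma upperUnipotent_apply (k : ℤ) : upperUnipotent k 0 0 = 1 ∧ upperUnipotent k 0 1 = k ∧
    upperUnipotent k 1 0 = 0 ∧ upperUnipotent k 1 1 = 1 := ⟨rfl, rfl, rfl, rfl⟩

lemma exists_mem_Gamma_mul_col_eq {q : ℕ} {g h : SL2Z} (h0 : g 0 0 ≡ h 0 0 [ZMOD q])
    (h1 : g 1 0 ≡ h 1 0 [ZMOD q]) :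
    ∃ γ ∈ Gamma q, (γ * g) 0 0 = h 0 0 ∧ (γ * g) 1 0 = h 1 0 := by
  let k := g 1 1 * h 0 1 - g 0 1 * h 1 1
  have hk00 : (h * upperUnipotent (-k)) 0 0 = h 0 0 := by simp [SL2Z_mul_apply, upperUnipotent_apply]
  have hk10 : (h * upperUnipotent (-k)) 1 0 = h 1 0 := by simp [SL2Z_mul_apply, upperUnipotent_apply]
  have hk01 : (h * upperUnipotent (-k)) 0 1 = h 0 1 - h 0 0 * k := by
    rw [SL2Z_mul_apply]; simp [upperUnipotent_apply]; ring
  have hk11 : (h * upperUnipotent (-k)) 1 1 = h 1 1 - h 1 0 * k := by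
    rw [SL2Z_mul_apply]; simp [upperUnipotent_apply]; ring
  refine ⟨h * upperUnipotent (-k) * g⁻¹, ?_, by rw [inv_mul_cancel_right, hk00],
    by rw [inv_mul_cancel_right, hk10]⟩
  have e0 := (ZMod.intCast_eq_intCast_iff _ _ q).mpr h0
  have e1 := (ZMod.intCast_eq_intCast_iff _ _ q).mpr h1
  have hdg := congrArg (Int.cast : ℤ → ZMod q) (SL2Z_det g)
  have hdh := congrArg (Int.cast : ℤ → ZMod q) (SL2Z_det h)
  push_cast at hdg hdh
  rw [Gamma_mem', map_mul, map_inv, mul_inv_eq_one]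
  ext i j
  fin_cases i <;> fin_cases j <;>
    simp only [Fin.zero_eta, Fin.mk_one, SL_reduction_mod_hom_val, hk00, hk10, hk01, hk11, e0, e1,
      k, Int.cast_sub, Int.cast_mul]
  · rw [← e0]
    rw [← e0, ← e1] at hdh
    linear_combination (-((h 0 1 : ℤ) : ZMod q)) * hdg + ((g 0 1 : ℤ) : ZMod q) * hdh
  · rw [← e1]
    rw [← e0, ← e1] at hdh
    linear_combination (-((h 1 1 : ℤ) : ZMod q)) * hdg + ((g 1 1 : ℤ) : ZMod q) * hdh

lemma cuspDatum_col_eq_iff {q n : ℕ} (hq : 0 < q) (hdvd : n ∣ q) (g h : SL2Z) :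
    cuspDatum q n (g 0 0) (g 1 0) = cuspDatum q n (h 0 0) (h 1 0) ↔
      ∃ γ ∈ GammaQN q n, (γ * g) 0 0 = h 0 0 ∧ (γ * g) 1 0 = h 1 0 := by
  have hnm : (n : ℤ) * (q / n : ℕ) = q := by exact_mod_cast Nat.mul_div_cancel' hdvd
  rw [cuspDatum_eq_iff hq hdvd]
  constructor
  · rintro ⟨hy, hx⟩
    obtain ⟨s, hs⟩ := hx.dvd
    rw [Nat.cast_mul, Int.gcd_eq_gcd_ab] at hs
    let τ := upperUnipotent (n * Int.gcdB (q / n : ℕ) (g 1 0) * s)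
    have hτ00 : (τ * g) 0 0 = g 0 0 + n * Int.gcdB (q / n : ℕ) (g 1 0) * s * g 1 0 := by
      simp [SL2Z_mul_apply, τ, upperUnipotent_apply]
    have hτ10 : (τ * g) 1 0 = g 1 0 := by simp [SL2Z_mul_apply, τ, upperUnipotent_apply]
    have hτ : τ ∈ GammaQN q n := by simp [mem_GammaQN, τ, upperUnipotent_apply]
    obtain ⟨γ, hγ, h0, h1⟩ := exists_mem_Gamma_mul_col_eq (q := q) (g := τ * g) (h := h)
      (Int.modEq_iff_dvd.mpr ⟨Int.gcdA (q / n : ℕ) (g 1 0) * s, by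
        rw [hτ00]
        linear_combination hs + (Int.gcdA (q / n : ℕ) (g 1 0) * s) * hnm⟩)
      (by rwa [hτ10])
    exact ⟨γ * τ, mul_mem (Gamma_le_GammaQN hdvd hγ) hτ, by rwa [mul_assoc], by rwa [mul_assoc]⟩
  · rintro ⟨γ, hγ, h0, h1⟩
    obtain ⟨⟨h00, h11, h10⟩, h01⟩ := mem_GammaQN.mp hγ
    rw [SL2Z_mul_apply] at h0 h1
    constructor
    · rw [← ZMod.intCast_eq_intCast_iff, ← h1]
      push_cast
      rw [h10, h11]
      ring
    · rw [ZMod.intCast_zmod_eq_zero_iff_dvd] at h01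
      have h00' : (q : ℤ) ∣ γ 0 0 - 1 := by
        rw [← ZMod.intCast_zmod_eq_zero_iff_dvd]
        push_cast
        rw [h00, sub_self]
      rw [Int.modEq_iff_dvd, ← h0, show γ 0 0 * g 0 0 + γ 0 1 * g 1 0 - g 0 0 =
        (γ 0 0 - 1) * g 0 0 + γ 0 1 * g 1 0 by ring, Nat.cast_mul]
      refine dvd_add (Dvd.dvd.mul_right ?_ _) (mul_dvd_mul h01 (Int.gcd_dvd_right _ _))
      refine dvd_trans ?_ h00'
      rw [← hnm]
      exact mul_dvd_mul_left _ (Int.gcd_dvd_left _ _)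

lemma mem_pm {G : Subgroup SL2Z} {g : SL2Z} : g ∈ pm G ↔ g ∈ G ∨ -g ∈ G := by
  constructor
  · intro h
    have hle : pm G ≤
        { carrier := {g | g ∈ G ∨ -g ∈ G}
          one_mem' := Or.inl G.one_mem
          mul_mem' := by
            rintro a b (ha | ha) (hb | hb)
            · exact Or.inl (mul_mem ha hb)
            · exact Or.inr (by simpa using mul_mem ha hb)
            · exact Or.inr (by simpa using mul_mem ha hb)
            · exact Or.inl (by simpa using mul_mem ha hb)
          inv_mem' := by
            rintro a (ha | ha)
            · exact Or.inl (inv_mem ha)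
            · exact Or.inr (by simpa [inv_neg] using inv_mem ha) } := by
      refine sup_le (fun a ha => Or.inl ha) ?_
      rw [Subgroup.zpowers_le]
      exact Or.inr (by simp)
    exact hle h
  · have hneg : (-1 : SL2Z) ∈ pm G := Subgroup.mem_sup_right (Subgroup.mem_zpowers _)
    rintro (h | h)
    · exact Subgroup.mem_sup_left h
    · have := mul_mem hneg (Subgroup.mem_sup_left h : -g ∈ pm G)
      simpa using this

lemma neg_one_notMem_GammaQN {q n : ℕ} (hq : 3 ≤ q) : (-1 : SL2Z) ∉ GammaQN q n := by
  intro h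
  have h1 := (mem_GammaQN.mp h).1.1
  have h2 : (((2 : ℕ) : ZMod q)) = 0 := by
    simp at h1
    push_cast
    linear_combination -h1
  rw [ZMod.natCast_eq_zero_iff] at h2
  exact absurd (Nat.le_of_dvd (by norm_num) h2) (by lia)

lemma index_GammaQN_eq_two_mul {q n : ℕ} (hq : 3 ≤ q) (hdvd : n ∣ q) :
    (GammaQN q n).index = 2 * (pm (GammaQN q n)).index := by
  have hfin : (GammaQN q n).FiniteIndex :=
    IsCongruenceSubgroup.finiteIndex ⟨q, by lia, Gamma_le_GammaQN hdvd⟩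
  refine card_eq_two_mul_card_of_fiber (X := SL2Z) (QuotientGroup.mk : SL2Z → SL2Z ⧸ GammaQN q n)
    (QuotientGroup.mk : SL2Z → SL2Z ⧸ pm (GammaQN q n)) (fun g => -g)
    QuotientGroup.mk_surjective QuotientGroup.mk_surjective (fun g k => ?_) fun g => ?_
  · rw [QuotientGroup.eq, QuotientGroup.eq, QuotientGroup.eq, mem_pm, mul_neg]
  · rw [Ne, QuotientGroup.eq, mul_neg, inv_mul_cancel]
    exact neg_one_notMem_GammaQN hq

/-- The residues in `cuspData q n` attached to the first column of a matrix. -/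
def colDatum {q n : ℕ} (hq : 0 < q) (hdvd : n ∣ q) (g : SL2Z) : cuspData q n :=
  ⟨cuspDatum q n (g 0 0) (g 1 0), cuspDatum_mem_cuspData hq hdvd (g.isCoprime_col 0)⟩

lemma colDatum_surjective {q n : ℕ} (hq : 0 < q) (hdvd : n ∣ q) :
    Function.Surjective (colDatum hq hdvd) := by
  rintro ⟨t, ht⟩
  obtain ⟨x, y, hxy, h⟩ := exists_cuspDatum_eq hq hdvd ht
  obtain ⟨g, rfl, rfl⟩ := hxy.exists_SL2_col 0
  exact ⟨g, Subtype.ext h⟩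

lemma colDatum_eq_iff {q n : ℕ} (hq : 0 < q) (hdvd : n ∣ q) (g h : SL2Z) :
    colDatum hq hdvd g = colDatum hq hdvd h ↔
      ∃ γ ∈ GammaQN q n, (γ * g) 0 0 = h 0 0 ∧ (γ * g) 1 0 = h 1 0 := by
  rw [← cuspDatum_col_eq_iff hq hdvd, colDatum, colDatum, Subtype.mk.injEq]

lemma index_Gamma1 {q : ℕ} (hq : 0 < q) : (Gamma1 q).index = (cuspData q q).card := by
  have hcard : Nat.card (cuspData q q) = (cuspData q q).card := by simp
  rw [← hcard]
  refine Subgroup.index_eq_card_of_surjective _ (colDatum hq dvd_rfl) (colDatum_surjective hq _)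
    fun g h => ?_
  obtain ⟨i00, i01, i10, i11⟩ := SL2Z_inv_apply g
  have hdg := congrArg (Int.cast : ℤ → ZMod q) (SL2Z_det g)
  have hdet := congrArg (Int.cast : ℤ → ZMod q) (SL2Z_det (g⁻¹ * h))
  push_cast at hdg hdet
  have hgcd : Int.gcd (q / q : ℕ) (g 1 0) = 1 := by simp [Nat.div_self hq]
  rw [colDatum, colDatum, Subtype.mk.injEq, cuspDatum_eq_iff hq dvd_rfl, hgcd, mul_one,
    ← ZMod.intCast_eq_intCast_iff, ← ZMod.intCast_eq_intCast_iff, Gamma1_mem]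
  have e00 : (((g⁻¹ * h) 0 0 : ℤ) : ZMod q) = g 1 1 * h 0 0 - g 0 1 * h 1 0 := by
    rw [SL2Z_mul_apply, i00, i01]; push_cast; ring
  have e10 : (((g⁻¹ * h) 1 0 : ℤ) : ZMod q) = g 0 0 * h 1 0 - g 1 0 * h 0 0 := by
    rw [SL2Z_mul_apply, i10, i11]; push_cast; ring
  constructor
  · rintro ⟨hy, hx⟩
    have h00 : (((g⁻¹ * h) 0 0 : ℤ) : ZMod q) = 1 := by
      rw [e00, ← hx, ← hy]; linear_combination hdg
    have h10 : (((g⁻¹ * h) 1 0 : ℤ) : ZMod q) = 0 := by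
      rw [e10, ← hx, ← hy]; ring
    refine ⟨h00, ?_, h10⟩
    rw [h00, h10] at hdet
    linear_combination hdet
  · rintro ⟨h00, -, h10⟩
    rw [e00] at h00
    rw [e10] at h10
    constructor
    · linear_combination (h 1 0 : ZMod q) * hdg - (g 1 0 : ZMod q) * h00 - (g 1 1 : ZMod q) * h10
    · linear_combination (h 0 0 : ZMod q) * hdg - (g 0 0 : ZMod q) * h00 - (g 0 1 : ZMod q) * h10

lemma index_GammaQN {q n : ℕ} (hq : 0 < q) (hdvd : n ∣ q) :
    (GammaQN q n).index = n * (cuspData q q).card := by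
  rw [← Subgroup.relIndex_mul_index (show GammaQN q n ≤ Gamma1 q from inf_le_left), index_Gamma1 hq]
  congr 1
  refine Eq.trans ?_ (Nat.card_zmod n)
  refine Subgroup.index_eq_card_of_surjective _
    (fun g : Gamma1 q => (((g : SL2Z) 0 1 : ℤ) : ZMod n)) (fun b => ?_) ?_
  · obtain ⟨k, rfl⟩ := ZMod.intCast_surjective b
    exact ⟨⟨upperUnipotent k, by simp [Gamma1_mem, upperUnipotent_apply]⟩, by simp [upperUnipotent_apply]⟩
  · rintro ⟨g, hg⟩ ⟨h, hh⟩
    obtain ⟨i00, i01, -, -⟩ := SL2Z_inv_apply g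
    have hmod : ∀ g : SL2Z, g ∈ Gamma1 q → ((g 1 1 : ℤ) : ZMod n) = 1 := by
      intro g hg
      have h1 := ((Gamma1_mem q g).mp hg).2.1
      have h2 := (ZMod.intCast_eq_intCast_iff _ 1 q).mp (by simpa using h1)
      simpa using (ZMod.intCast_eq_intCast_iff _ 1 n).mpr
        (h2.of_dvd (Int.natCast_dvd_natCast.mpr hdvd))
    rw [Subgroup.mem_subgroupOf]
    change _ ↔ g⁻¹ * h ∈ Gamma1 q ⊓ GammaUpper n
    rw [Subgroup.mem_inf, and_iff_right (mul_mem (inv_mem hg) hh)]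
    change _ ↔ (((g⁻¹ * h) 0 1 : ℤ) : ZMod n) = 0
    rw [SL2Z_mul_apply, i00, i01]
    push_cast
    rw [hmod g hg, hmod h hh]
    constructor
    · intro e
      linear_combination -e
    · intro e
      linear_combination -e

lemma moebius_none (g : SL2Z) : moebius g none =
    if g 1 0 = 0 then none else some ((g 0 0 : ℚ) / g 1 0) := by
  simp [moebius]

lemma moebius_none_surjective : Function.Surjective fun g : SL2Z => moebius g none := by
  rintro (_ | t)
  · exact ⟨1, by simp [moebius_none]⟩
  · obtain ⟨g, h0, h1⟩ := (Int.isCoprime_iff_nat_coprime.mpr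
      (by simpa using t.reduced) : IsCoprime t.num t.den).exists_SL2_col 0
    refine ⟨g, ?_⟩
    simp only [moebius_none]
    rw [h0, h1, if_neg (by exact_mod_cast t.den_ne_zero), Int.cast_natCast, Rat.num_div_den]

lemma moebius_moebius_none (γ g : SL2Z) : moebius γ (moebius g none) = moebius (γ * g) none := by
  rw [moebius_none, moebius_none, SL2Z_mul_apply, SL2Z_mul_apply]
  by_cases hy : g 1 0 = 0
  · have hx : g 0 0 ≠ 0 := by
      intro hx
      have := SL2Z_det g
      simp [hx, hy] at this
    simp only [hy, if_true, moebius_none, mul_zero, add_zero, mul_eq_zero, hx, or_false]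
    split_ifs with h
    · rfl
    · have hx' : (g 0 0 : ℚ) ≠ 0 := by exact_mod_cast hx
      push_cast
      rw [mul_div_mul_right _ _ hx']
  · have hy' : (g 1 0 : ℚ) ≠ 0 := by exact_mod_cast hy
    have e : ((γ 1 0 : ℤ) : ℚ) * (g 0 0 / g 1 0) + γ 1 1 =
        ((γ 1 0 * g 0 0 + γ 1 1 * g 1 0 : ℤ) : ℚ) / g 1 0 := by
      push_cast; field_simp
    have e' : ((γ 0 0 : ℤ) : ℚ) * (g 0 0 / g 1 0) + γ 0 1 =
        ((γ 0 0 * g 0 0 + γ 0 1 * g 1 0 : ℤ) : ℚ) / g 1 0 := by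
      push_cast; field_simp
    simp only [hy, if_false, moebius]
    rw [e, e', div_div_div_cancel_right₀ hy']
    simp only [div_eq_zero_iff, hy', or_false, Int.cast_eq_zero]

lemma moebius_none_eq_iff (g h : SL2Z) : moebius g none = moebius h none ↔
    (g 0 0 = h 0 0 ∧ g 1 0 = h 1 0) ∨ (g 0 0 = -h 0 0 ∧ g 1 0 = -h 1 0) := by
  constructor
  · intro e
    have hcross : g 0 0 * h 1 0 = h 0 0 * g 1 0 := by
      rw [moebius_none, moebius_none] at e
      split_ifs at e with h1 h2 h2
      · rw [h1, h2, mul_zero, mul_zero]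
      · have h1' : (g 1 0 : ℚ) ≠ 0 := by exact_mod_cast h1
        have h2' : (h 1 0 : ℚ) ≠ 0 := by exact_mod_cast h2
        rw [Option.some.injEq, div_eq_div_iff h1' h2'] at e
        exact_mod_cast e
    obtain ⟨hg, hh⟩ := And.intro (SL2Z_det g) (SL2Z_det h)
    have hu : IsUnit (g 1 1 * h 0 0 - g 0 1 * h 1 0) := by
      refine IsUnit.of_mul_eq_one (h 1 1 * g 0 0 - h 0 1 * g 1 0) ?_
      linear_combination (g 1 1 * h 0 1 - h 1 1 * g 0 1) * hcross +
        (h 0 0 * h 1 1 - h 0 1 * h 1 0) * hg + hh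
    have e0 : h 0 0 = g 0 0 * (g 1 1 * h 0 0 - g 0 1 * h 1 0) := by
      linear_combination g 0 1 * hcross - h 0 0 * hg
    have e1 : h 1 0 = g 1 0 * (g 1 1 * h 0 0 - g 0 1 * h 1 0) := by
      linear_combination g 1 1 * hcross - h 1 0 * hg
    rcases Int.isUnit_iff.mp hu with h1 | h1 <;> rw [h1] at e0 e1
    · left; constructor <;> linarith
    · right; constructor <;> linarith
  · rintro (⟨h0, h1⟩ | ⟨h0, h1⟩) <;> simp [moebius_none, h0, h1]

lemma cuspRel_moebius_none_iff {q n : ℕ} (hq : 0 < q) (hdvd : n ∣ q) (g h : SL2Z) :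
    cuspRel (GammaQN q n) (moebius g none) (moebius h none) ↔
      colDatum hq hdvd g = colDatum hq hdvd h ∨ colDatum hq hdvd g = colDatum hq hdvd (-h) := by
  rw [colDatum_eq_iff, colDatum_eq_iff, ← exists_or]
  refine exists_congr fun γ => ?_
  rw [← and_or_left, moebius_moebius_none, moebius_none_eq_iff]
  simp

lemma cuspRel_equivalence (G : Subgroup SL2Z) : Equivalence (cuspRel G) where
  refl x := by
    obtain ⟨g, rfl⟩ := moebius_none_surjective x
    exact ⟨1, G.one_mem, by rw [moebius_moebius_none, one_mul]⟩
  symm := by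
    rintro x _ ⟨γ, hγ, rfl⟩
    obtain ⟨g, rfl⟩ := moebius_none_surjective x
    exact ⟨γ⁻¹, inv_mem hγ, by simp only [moebius_moebius_none, inv_mul_cancel_left]⟩
  trans := by
    rintro x _ _ ⟨γ, hγ, rfl⟩ ⟨δ, hδ, rfl⟩
    obtain ⟨g, rfl⟩ := moebius_none_surjective x
    exact ⟨δ * γ, mul_mem hδ hγ, by simp only [moebius_moebius_none, mul_assoc]⟩

lemma card_cuspData_eq_two_mul_numCusps {q n : ℕ} (hq : 5 ≤ q) (hdvd : n ∣ q) :
    (cuspData q n).card = 2 * numCusps (GammaQN q n) := by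
  have hq0 : 0 < q := by lia
  have hcard : Nat.card (cuspData q n) = (cuspData q n).card := by simp
  rw [← hcard]
  refine card_eq_two_mul_card_of_fiber (colDatum hq0 hdvd)
    (fun g => Quot.mk (cuspRel (GammaQN q n)) (moebius g none)) (fun g => -g)
    (colDatum_surjective hq0 hdvd) (Quot.mk_surjective.comp moebius_none_surjective)
    (fun g h => ?_) fun g => ?_
  · rw [(cuspRel_equivalence _).quot_mk_eq_iff, cuspRel_moebius_none_iff hq0 hdvd]
  · rw [colDatum, colDatum, Ne, Subtype.mk.injEq]
    simpa using cuspDatum_ne_cuspDatum_neg hq hdvd (g.isCoprime_col 0)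

theorem stmt8 (q n : ℕ) (hq : 5 ≤ q) (hn : 0 < n) (hdvd : n ∣ q) :
    1 - (numCusps (GammaQN q n) : ℚ) / 2 + ((pm (GammaQN q n)).index : ℚ) / 12 =
      1 + ((q : ℚ) - 6 * calN (q / n)) * (n : ℚ) * (q : ℚ) / 24 * ∏ p ∈ q.primeFactors, (1 - 1 / (p : ℚ) ^ 2) := by
  have hq0 : 0 < q := by lia
  have hcusps := card_cuspData hq0 hdvd
  rw [card_cuspData_eq_two_mul_numCusps hq hdvd,
    totientQ_mul_gcdWeight_eq hq0.ne' (Nat.div_dvd_of_dvd hdvd)] at hcusps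
  have hindex := card_cuspData hq0 (dvd_refl q)
  rw [Nat.div_self hq0, totientQ_mul_gcdWeight_eq hq0.ne' (one_dvd q)] at hindex
  have hpm : (n : ℚ) * (cuspData q q).card = 2 * (pm (GammaQN q n)).index := by
    exact_mod_cast (index_GammaQN hq0 hdvd).symm.trans (index_GammaQN_eq_two_mul (by lia) hdvd)
  have hone : calN 1 = 1 := by simp [calN]
  rw [hindex, hone] at hpm
  push_cast at hcusps
  linear_combination -(1 / 4) * hcusps - (1 / 24) * hpm
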